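/- Consider the CnCZK audit model: there are N data points indexed by a type of size N, a fixed set B of c corrupted points (c ≤ N), and an L-layer model with 1 ≤ s ≤ L. For each corrupted point i the adversary's deviation is detected exactly when an audited layer lies in a fixed nonempty set E_i of layers associated to i. The verifier draws a uniformly random m-element subset S of the N points (m ≤ N) and, independently for each point i, a uniformly random s-element subset T_i of the L layers; detection occurs iff there exists i ∈ S ∩ B with T_i ∩ E_i ≠ ∅. Then the probability of detection is at least ∑_{k=0}^{min(c,m)} [C(c,k)·C(N−c,m−k)/C(N,m)] · [1 − ((L−s)/L)^k], where C(·,·) denotes the binomial coefficient. -/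

import Mathlib

open Finset

theorem aux_choose (L s e : ℕ) (he : 1 ≤ e) (heL : e ≤ L) (hsL : s ≤ L) :
    ((L - e).choose s : ℝ) ≤ ((L : ℝ) - s) / L * (L.choose s : ℝ) := by
  obtain ⟨n, rfl⟩ : ∃ n, L = n + 1 := ⟨L - 1, by omega⟩
  have h1 : (n + 1 - e).choose s ≤ n.choose s := Nat.choose_le_choose s (by omega)
  have h2 := Nat.choose_mul_succ_eq n s
  have h3 : (n.choose s : ℝ) * ((n : ℝ) + 1) = ((n + 1).choose s : ℝ) * ((n : ℝ) + 1 - s) := by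
    have : ((n + 1 - s : ℕ) : ℝ) = (n : ℝ) + 1 - s := by
      rw [Nat.cast_sub hsL]; push_cast; ring
    rw [← this]; exact_mod_cast h2
  have h4 : ((n + 1 - e).choose s : ℝ) ≤ n.choose s := by exact_mod_cast h1
  refine h4.trans (le_of_eq ?_)
  push_cast
  have : (n : ℝ) + 1 ≠ 0 := by positivity
  field_simp
  linarith

theorem aux_fiber {α : Type} [Fintype α] [DecidableEq α] (B : Finset α) (m k : ℕ) (hk : k ≤ m) :
    (((Finset.univ : Finset α).powersetCard m).filter (fun S => (S ∩ B).card = k)).card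
      = B.card.choose k * (Fintype.card α - B.card).choose (m - k) := by
  rw [← Finset.card_compl, ← Finset.card_powersetCard, ← Finset.card_powersetCard,
    ← Finset.card_product]
  refine Finset.card_nbij' (fun S => (S ∩ B, S ∩ Bᶜ)) (fun p => p.1 ∪ p.2) ?_ ?_ ?_ ?_
  · intro S hS
    simp only [Finset.coe_filter, Finset.mem_powersetCard, Set.mem_setOf_eq] at hS
    have := Finset.card_inter_add_card_sdiff S B
    rw [Finset.sdiff_eq_inter_compl] at this
    simp only [Finset.coe_product, Set.mem_prod, Finset.mem_coe, Finset.mem_powersetCard]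
    refine ⟨⟨Finset.inter_subset_right, hS.2⟩, Finset.inter_subset_right, by omega⟩
  · rintro ⟨X, Y⟩ h
    simp only [Finset.coe_product, Set.mem_prod, Finset.mem_coe, Finset.mem_powersetCard] at h
    obtain ⟨⟨hX, hXc⟩, hY, hYc⟩ := h
    have hd : Disjoint X Y :=
      Finset.disjoint_of_subset_left hX
        (Finset.disjoint_of_subset_right hY disjoint_compl_right)
    simp only [Finset.coe_filter, Finset.mem_powersetCard, Set.mem_setOf_eq]
    refine ⟨⟨Finset.subset_univ _, ?_⟩, ?_⟩
    · rw [Finset.card_union_of_disjoint hd]; omega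
    · have : (X ∪ Y) ∩ B = X := by
        ext a
        have h1 := @hX a
        have h2 := @hY a
        simp only [Finset.mem_compl] at h2
        simp only [Finset.mem_inter, Finset.mem_union]
        tauto
      rw [this, hXc]
  · intro S _
    ext a
    simp only [Finset.mem_inter, Finset.mem_union, Finset.mem_compl]
    tauto
  · rintro ⟨X, Y⟩ h
    simp only [Finset.coe_product, Set.mem_prod, Finset.mem_coe, Finset.mem_powersetCard] at h
    obtain ⟨⟨hX, hXc⟩, hY, hYc⟩ := h
    ext a
    all_goals
      have h1 := @hX a
      have h2 := @hY a
      simp only [Finset.mem_compl] at h2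
      simp only [Finset.mem_inter, Finset.mem_union, Finset.mem_compl]
      tauto

theorem aux_detect {α β : Type} [Fintype α] [DecidableEq α] [Fintype β] [DecidableEq β]
    (s : ℕ) (hsL : s ≤ Fintype.card β) (D : Finset α)
    (E : α → Finset β) (hE : ∀ i ∈ D, (E i).Nonempty) :
    ((Fintype.card β).choose s : ℝ) ^ Fintype.card α *
        (1 - (((Fintype.card β : ℝ) - s) / Fintype.card β) ^ D.card) ≤
      (((Fintype.piFinset fun _ : α => (Finset.univ : Finset β).powersetCard s).filter
        (fun T => ∃ i ∈ D, (T i ∩ E i).Nonempty)).card : ℝ) := by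
  set P := Fintype.piFinset fun _ : α => (Finset.univ : Finset β).powersetCard s with hP
  have hPc : P.card = (Fintype.card β).choose s ^ Fintype.card α := by
    simp [hP, Fintype.card_piFinset, Finset.card_univ]
  have hsplit := Finset.card_filter_add_card_filter_not (s := P)
    (fun T => ∃ i ∈ D, (T i ∩ E i).Nonempty)
  have hsub : P.filter (fun T => ¬ ∃ i ∈ D, (T i ∩ E i).Nonempty) ⊆
      Fintype.piFinset (fun i : α => (if i ∈ D then (E i)ᶜ else Finset.univ).powersetCard s) := by
    intro T hT
    simp only [hP, Finset.mem_filter, Fintype.mem_piFinset, Finset.mem_powersetCard] at hT ⊢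
    intro i
    refine ⟨?_, (hT.1 i).2⟩
    split_ifs with hi
    · intro x hx
      rw [Finset.mem_compl]
      intro hxE
      exact hT.2 ⟨i, hi, x, Finset.mem_inter.2 ⟨hx, hxE⟩⟩
    · exact Finset.subset_univ _
  have hle := Finset.card_le_card hsub
  rw [Fintype.card_piFinset] at hle
  have hle' : ((P.filter (fun T => ¬ ∃ i ∈ D, (T i ∩ E i).Nonempty)).card : ℝ) ≤
      (((Fintype.card β : ℝ) - s) / Fintype.card β) ^ D.card *
        ((Fintype.card β).choose s : ℝ) ^ Fintype.card α := by
    calc _ ≤ ((∏ i : α, ((if i ∈ D then (E i)ᶜ else Finset.univ).powersetCard s).card : ℕ) : ℝ) := by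
            exact_mod_cast hle
      _ ≤ ∏ i : α, ((if i ∈ D then (((Fintype.card β : ℝ) - s) / Fintype.card β) else 1) *
            ((Fintype.card β).choose s : ℝ)) := by
          push_cast
          refine Finset.prod_le_prod (fun _ _ => by positivity) ?_
          intro i _
          rw [Finset.card_powersetCard]
          split_ifs with hi
          · rw [Finset.card_compl]
            exact aux_choose _ _ _ (hE i hi).card_pos (Finset.card_le_univ _) hsL
          · simp [Finset.card_univ]
      _ = _ := by
          rw [Finset.prod_mul_distrib]
          simp [Finset.card_univ, div_pow]
  have hs' : ((P.filter (fun T => ∃ i ∈ D, (T i ∩ E i).Nonempty)).card : ℝ) +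
      ((P.filter (fun T => ¬ ∃ i ∈ D, (T i ∩ E i).Nonempty)).card : ℝ) =
      ((Fintype.card β).choose s : ℝ) ^ Fintype.card α := by
    rw [hPc] at hsplit
    exact_mod_cast hsplit
  linarith

/-- **CnCZK cheating-detection probability (Theorem 1).**
The verifier samples a uniformly random `m`-element subset `S` of the `N` data points
and, independently for each point `i`, a uniformly random `s`-element subset `T i`
of the `L` layers.  Detection occurs iff some corrupted point `i ∈ S ∩ B` has an
audited layer in its exposing set `E i`.  The detection probability is bounded below
by the hypergeometric sum `∑_k C(c,k)C(N-c,m-k)/C(N,m) · (1 - ((L-s)/L)^k)`. -/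
theorem cnczk_detection_prob_lower_bound
    (α β : Type) [Fintype α] [DecidableEq α] [Fintype β] [DecidableEq β]
    (N L s m c : ℕ)
    (hN : Fintype.card α = N) (hL : Fintype.card β = L)
    (B : Finset α) (hB : B.card = c) (hcN : c ≤ N)
    (hs1 : 1 ≤ s) (hsL : s ≤ L) (hm : m ≤ N)
    (E : α → Finset β) (hE : ∀ i ∈ B, (E i).Nonempty) :
    (((((Finset.univ : Finset α).powersetCard m) ×ˢ
          (Fintype.piFinset fun _ : α => (Finset.univ : Finset β).powersetCard s)).filter
          (fun p => ∃ i ∈ p.1 ∩ B, ((p.2 i) ∩ E i).Nonempty)).card : ℝ) /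
      ((((Finset.univ : Finset α).powersetCard m) ×ˢ
          (Fintype.piFinset fun _ : α => (Finset.univ : Finset β).powersetCard s)).card : ℝ)
    ≥ ∑ k ∈ Finset.range (min c m + 1),
        ((Nat.choose c k * Nat.choose (N - c) (m - k) : ℝ) / (Nat.choose N m : ℝ)) *
          (1 - (((L : ℝ) - s) / L) ^ k) := by
  subst hN hL hB
  set P := Fintype.piFinset fun _ : α => (Finset.univ : Finset β).powersetCard s with hP
  set A := (Finset.univ : Finset α).powersetCard m with hA
  have hPc : P.card = (Fintype.card β).choose s ^ Fintype.card α := by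
    simp [hP, Fintype.card_piFinset, Finset.card_univ]
  have hAc : A.card = (Fintype.card α).choose m := by
    simp [hA, Finset.card_univ]
  set q : ℝ := ((Fintype.card β : ℝ) - s) / Fintype.card β with hq
  have hM : (0 : ℝ) < ((Fintype.card β).choose s : ℝ) ^ Fintype.card α := by
    have := Nat.choose_pos hsL
    positivity
  have hC : (0 : ℝ) < ((Fintype.card α).choose m : ℝ) := by
    exact_mod_cast Nat.choose_pos hm
  have hnum : ((A ×ˢ P).filter (fun p => ∃ i ∈ p.1 ∩ B, ((p.2 i) ∩ E i).Nonempty)).card =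
      ∑ S ∈ A, (P.filter (fun T => ∃ i ∈ S ∩ B, (T i ∩ E i).Nonempty)).card := by
    rw [Finset.card_filter, Finset.sum_product]
    simp only [Finset.card_filter]
  have hsum : ∑ S ∈ A, (1 - q ^ (S ∩ B).card) =
      ∑ k ∈ Finset.range (min B.card m + 1),
        (B.card.choose k * (Fintype.card α - B.card).choose (m - k) : ℝ) * (1 - q ^ k) := by
    rw [← Finset.sum_fiberwise_of_maps_to (s := A) (t := Finset.range (min B.card m + 1))
      (g := fun S => (S ∩ B).card)]
    · refine Finset.sum_congr rfl fun k hk => ?_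
      have hk' : k ≤ m := by
        have := Finset.mem_range.1 hk
        omega
      rw [Finset.sum_congr rfl (g := fun _ => 1 - q ^ k)
        (fun S hS => by rw [(Finset.mem_filter.1 hS).2]), Finset.sum_const, hA,
        aux_fiber B m k hk', nsmul_eq_mul]
      push_cast
      rfl
    · intro S hS
      have h1 := Finset.card_le_card (Finset.inter_subset_left : S ∩ B ⊆ S)
      have h2 := Finset.card_le_card (Finset.inter_subset_right : S ∩ B ⊆ B)
      have h3 := (Finset.mem_powersetCard.1 hS).2
      rw [Finset.mem_range]
      omega
  have hR : ∑ k ∈ Finset.range (min B.card m + 1),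
        ((B.card.choose k * (Fintype.card α - B.card).choose (m - k) : ℝ) /
          ((Fintype.card α).choose m : ℝ)) * (1 - q ^ k) =
      (∑ S ∈ A, (1 - q ^ (S ∩ B).card)) / ((Fintype.card α).choose m : ℝ) := by
    rw [hsum, Finset.sum_div]
    exact Finset.sum_congr rfl fun k _ => by ring
  rw [hR, hnum, Finset.card_product, hPc, hAc, ge_iff_le]
  push_cast
  rw [div_le_div_iff₀ hC (by positivity)]
  have key : ((Fintype.card β).choose s : ℝ) ^ Fintype.card α *
      ∑ S ∈ A, (1 - q ^ (S ∩ B).card) ≤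
      ∑ S ∈ A, ((P.filter (fun T => ∃ i ∈ S ∩ B, (T i ∩ E i).Nonempty)).card : ℝ) := by
    rw [Finset.mul_sum]
    refine Finset.sum_le_sum fun S _ => ?_
    exact aux_detect s hsL (S ∩ B) E (fun i hi => hE i (Finset.mem_inter.1 hi).2)
  have := mul_le_mul_of_nonneg_right key hC.le
  linarith
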